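/- arXiv:2604.08311 — 3 statements merged into one kernel-verified Lean document; each statement's English description precedes it below -/
import Mathlib

section
/- Let n = 2m, N = 2^n − 1, and d_1, d_2 ∈ {1, …, N−1}. If (j_1, j_2) ∈ 𝒥 satisfies (j_1 + j_2) mod N ≥ 2^n − 2^m + 1, then V_{d_1,d_2}(j_1, j_2) ≥ m + 1. -/
open Finset

/-- `wt₂(j)`: the binary digit sum of the representative of `j mod N` in `{0, …, N−1}`. -/
def wt2 (N : ℕ) (j : ℤ) : ℕ := (Nat.digits 2 (j % (N : ℤ)).toNat).sum

/-- `𝒥 = ({0,…,N−1} × {0,…,N−1}) \ {(0,0)}`. -/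
def JJ (N : ℕ) : Finset (ℕ × ℕ) := ((Finset.range N) ×ˢ (Finset.range N)).erase (0, 0)

/-- `V_{d₁,d₂}(j₁,j₂) = wt₂(j₁) + wt₂(j₂) + wt₂(−d₁j₁ − d₂j₂)`. -/
def Vfun (N d₁ d₂ : ℕ) (p : ℕ × ℕ) : ℕ :=
  wt2 N (p.1 : ℤ) + wt2 N (p.2 : ℤ) + wt2 N (-((d₁ : ℤ) * p.1 + (d₂ : ℤ) * p.2))

theorem sum_digits_two (a : ℕ) :
    (Nat.digits 2 a).sum = a % 2 + (Nat.digits 2 (a / 2)).sum := by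
  rcases Nat.eq_zero_or_pos a with rfl | h
  · simp
  · rw [Nat.digits_def' (by norm_num) h, List.sum_cons]

theorem sum_digits_two_add_le (a b : ℕ) :
    (Nat.digits 2 (a + b)).sum ≤ (Nat.digits 2 a).sum + (Nat.digits 2 b).sum := by
  induction hs : a + b using Nat.strong_induction_on generalizing a b with
  | _ s ih =>
    subst hs
    rcases Nat.eq_zero_or_pos a with rfl | ha
    · simp
    rcases Nat.eq_zero_or_pos b with rfl | hb
    · simp
    rw [sum_digits_two (a + b), sum_digits_two a, sum_digits_two b]
    have h₁ := ih (a / 2 + b / 2) (by lia) (a / 2) (b / 2) rfl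
    rcases Nat.lt_or_ge (a % 2 + b % 2) 2 with h | h
    · rw [show (a + b) / 2 = a / 2 + b / 2 by lia]
      lia
    · have h₂ := ih (a / 2 + b / 2 + 1) (by lia) (a / 2 + b / 2) 1 rfl
      rw [show (a + b) / 2 = a / 2 + b / 2 + 1 by lia]
      simp only [Nat.one_lt_ofNat, Nat.digits_of_lt 2 1 one_ne_zero, List.sum_singleton] at h₂
      lia

theorem sum_digits_two_pow_mul_add (k q r : ℕ) (hr : r < 2 ^ k) :
    (Nat.digits 2 (2 ^ k * q + r)).sum = (Nat.digits 2 q).sum + (Nat.digits 2 r).sum := by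
  induction k generalizing r with
  | zero => simp_all
  | succ k ih =>
    have hk : 2 ^ (k + 1) * q = 2 * (2 ^ k * q) := by ring
    rw [sum_digits_two (2 ^ (k + 1) * q + r), sum_digits_two r,
      show (2 ^ (k + 1) * q + r) / 2 = 2 ^ k * q + r / 2 by lia, ih (r / 2) (by lia)]
    lia

theorem sum_digits_two_pos {r : ℕ} (hr : 0 < r) : 0 < (Nat.digits 2 r).sum := by
  induction r using Nat.strong_induction_on with
  | _ r ih =>
    rw [sum_digits_two]
    rcases Nat.eq_zero_or_pos (r / 2) with h | h
    · lia
    · have := ih (r / 2) (by lia) h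
      lia

theorem sum_digits_two_pow_sub_one (k : ℕ) : (Nat.digits 2 (2 ^ k - 1)).sum = k := by
  induction k with
  | zero => simp
  | succ k ih =>
    have := Nat.two_pow_pos k
    rw [sum_digits_two, show (2 ^ (k + 1) - 1) / 2 = 2 ^ k - 1 by lia, ih]
    lia

/-- The binary digit sum is subadditive modulo `2 ^ n - 1`. -/
theorem sum_digits_two_add_mod_le {n a b : ℕ} (ha : a < 2 ^ n - 1) (hb : b < 2 ^ n - 1) :
    (Nat.digits 2 ((a + b) % (2 ^ n - 1))).sum ≤
      (Nat.digits 2 a).sum + (Nat.digits 2 b).sum := by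
  have hab := sum_digits_two_add_le a b
  rcases Nat.lt_or_ge (a + b) (2 ^ n - 1) with h | h
  · rwa [Nat.mod_eq_of_lt h]
  rw [Nat.mod_eq_sub_mod h, Nat.mod_eq_of_lt (by lia)]
  rcases h.eq_or_lt with h | h
  · simp [← h]
  have hcarry := sum_digits_two_pow_mul_add n 1 (a + b - 2 ^ n) (by lia)
  have hone := sum_digits_two_add_le (a + b - 2 ^ n) 1
  rw [show 2 ^ n * 1 + (a + b - 2 ^ n) = a + b by lia] at hcarry
  rw [show a + b - 2 ^ n + 1 = a + b - (2 ^ n - 1) by lia] at hone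
  lia

theorem lt_sum_digits_two {m s : ℕ} (hs : 2 ^ (2 * m) - 2 ^ m < s) (hs' : s < 2 ^ (2 * m)) :
    m < (Nat.digits 2 s).sum := by
  have hsq : 2 ^ (2 * m) = 2 ^ m * 2 ^ m := by ring
  have hmul : 2 ^ m * (2 ^ m - 1) = 2 ^ (2 * m) - 2 ^ m := by
    rw [Nat.mul_sub, mul_one, hsq]
  have hle : 2 ^ m ≤ 2 ^ (2 * m) := Nat.pow_le_pow_right (by norm_num) (by lia)
  obtain ⟨r, rfl⟩ := Nat.exists_eq_add_of_lt hs
  rw [← hmul, add_assoc, sum_digits_two_pow_mul_add _ _ _ (by lia), sum_digits_two_pow_sub_one]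
  have := sum_digits_two_pos (Nat.succ_pos r)
  lia

theorem wt2_natCast_of_lt {N j : ℕ} (hj : j < N) : wt2 N (j : ℤ) = (Nat.digits 2 j).sum := by
  rw [wt2, ← Int.natCast_mod, Int.toNat_natCast, Nat.mod_eq_of_lt hj]

/-- Let `n = 2m`, `N = 2^n − 1`, `d₁, d₂ ∈ {1, …, N−1}`.  If `(j₁, j₂) ∈ 𝒥` satisfies
`(j₁ + j₂) mod N ≥ 2^n − 2^m + 1`, then `V_{d₁,d₂}(j₁, j₂) ≥ m + 1`. -/
theorem stmt5 (m n : ℕ) (hm : 0 < m) (hn : n = 2 * m) (N : ℕ) (hN : N = 2 ^ n - 1)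
    (d₁ d₂ : ℕ) (hd₁ : 1 ≤ d₁) (hd₁' : d₁ ≤ N - 1) (hd₂ : 1 ≤ d₂) (hd₂' : d₂ ≤ N - 1)
    (p : ℕ × ℕ) (hp : p ∈ JJ N)
    (hsum : 2 ^ n - 2 ^ m + 1 ≤ (p.1 + p.2) % N) :
    m + 1 ≤ Vfun N d₁ d₂ p := by
  subst hN hn
  simp only [JJ, mem_erase, mem_product, mem_range] at hp
  obtain ⟨-, h₁, h₂⟩ := hp
  have hlt := Nat.mod_lt (p.1 + p.2) (Nat.zero_lt_of_lt h₁)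
  have hwt := lt_sum_digits_two hsum (by lia)
  have hadd := sum_digits_two_add_mod_le h₁ h₂
  rw [Vfun, wt2_natCast_of_lt h₁, wt2_natCast_of_lt h₂]
  lia
end

section
/- Let n = 2m and let F : F_{2^n} → F_{2^n} be a function satisfying F(x^2) = F(x)^2 for all x and #S_F = 2^m. If ℓ(n) > m, then S_F = F_{2^m}, the subfield of F_{2^n} with 2^m elements. -/
open Finset

/-- The Walsh transform `W_{F_a}(ω) = Σ_v (−1)^{Tr(a·F(v)) + Tr(ω·v)}`. -/
noncomputable def walsh {K : Type*} [Field K] [Fintype K] [Algebra (ZMod 2) K]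
    (F : K → K) (a ω : K) : ℤ :=
  ∑ v : K, if Algebra.trace (ZMod 2) K (a * F v) + Algebra.trace (ZMod 2) K (ω * v) = 0
    then 1 else -1

/-- The component `F_a` is bent: all Walsh values are `±2^m`. -/
def IsBent {K : Type*} [Field K] [Fintype K] [Algebra (ZMod 2) K]
    (m : ℕ) (F : K → K) (a : K) : Prop :=
  ∀ ω : K, walsh F a ω = 2 ^ m ∨ walsh F a ω = -(2 ^ m)

/-- The `F₂`-span of the Frobenius orbit `{γ, γ², γ⁴, …}` of `γ`. -/
def frobSpan (K : Type*) [Field K] [Algebra (ZMod 2) K] (γ : K) : Submodule (ZMod 2) K :=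
  Submodule.span (ZMod 2) (Set.range fun i : ℕ => γ ^ (2 ^ i))

open Polynomial

/-- In an elementary abelian `2`-group, a set containing `0` that is not closed under addition
meets trivially some subgroup of index smaller than its cardinality. -/
theorem exists_addSubgroup_index_lt_ncard {G : Type*} [AddCommGroup G] [Finite G]
    (h2 : ∀ x : G, x + x = 0) {S : Set G} (h0 : 0 ∈ S) {a b : G} (ha : a ∈ S) (hb : b ∈ S)
    (hab : a + b ∉ S) :
    ∃ U : AddSubgroup G, (∀ x ∈ U, x ∈ S → x = 0) ∧ U.index < S.ncard := by
  have mem_pair : ∀ x y : G, y ∈ AddSubgroup.zmultiples x → y = 0 ∨ y = x := by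
    rintro x y ⟨k, rfl⟩
    rcases Int.even_or_odd' k with ⟨j, rfl | rfl⟩
    · left; simp [mul_comm 2 j, mul_smul, two_smul, h2]
    · right; simp [mul_comm 2 j, mul_smul, add_smul, two_smul, h2]
  obtain ⟨U, hU⟩ := (Set.toFinite {U : AddSubgroup G | a + b ∈ U ∧
      ∀ x ∈ U, x ∈ S → x = 0}).exists_maximal
    ⟨AddSubgroup.zmultiples (a + b), AddSubgroup.mem_zmultiples _, fun x hx hxS => by
      rcases mem_pair _ _ hx with h | h
      · exact h
      · exact absurd (h ▸ hxS) hab⟩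
  obtain ⟨hUab, hUS⟩ := hU.prop
  refine ⟨U, hUS, ?_⟩
  have surj : ∀ q : G ⧸ U, ∃ s ∈ S, (s : G ⧸ U) = q := by
    intro q
    obtain ⟨x, rfl⟩ := QuotientAddGroup.mk_surjective q
    by_cases hx : x ∈ U
    · exact ⟨0, h0, by rw [QuotientAddGroup.eq]; simpa using hx⟩
    by_contra! hne
    refine hx (hU.le_of_ge (y := U ⊔ AddSubgroup.zmultiples x)
      ⟨AddSubgroup.mem_sup_left hUab, fun s hs hsS => ?_⟩ le_sup_left
      (AddSubgroup.mem_sup_right (AddSubgroup.mem_zmultiples x)))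
    obtain ⟨u, hu, y, hy, rfl⟩ := AddSubgroup.mem_sup.1 hs
    rcases mem_pair _ _ hy with rfl | rfl
    · exact hUS _ (by simpa using hu) hsS
    · refine absurd ?_ (hne _ hsS)
      rw [eq_comm, QuotientAddGroup.eq]
      simpa [add_comm u] using hu
  have hab_ne : a ≠ b := fun h => hab (by rw [h, h2]; exact h0)
  have himage : (fun s : G => (s : G ⧸ U)) '' (S \ {a}) = Set.univ := by
    refine Set.eq_univ_of_forall fun q => ?_
    obtain ⟨s, hs, rfl⟩ := surj q
    by_cases hsa : s = a
    · refine ⟨b, ⟨hb, hab_ne.symm⟩, ?_⟩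
      subst hsa
      have : -b = b := neg_eq_of_add_eq_zero_left (h2 b)
      rw [QuotientAddGroup.eq, this, add_comm]
      exact hUab
    · exact ⟨s, ⟨hs, hsa⟩, rfl⟩
  calc U.index = (Set.univ : Set (G ⧸ U)).ncard := by rw [Set.ncard_univ]; rfl
    _ ≤ (S \ {a}).ncard := himage ▸ Set.ncard_image_le (Set.toFinite _)
    _ < S.ncard := Set.ncard_sdiff_singleton_lt_of_mem ha (Set.toFinite _)

theorem pow_two_pow_mem {K : Type*} [Field K] [Algebra (ZMod 2) K]
    {V : Submodule (ZMod 2) K} (hV : ∀ x ∈ V, x ^ 2 ∈ V) {x : K}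
    (hx : x ∈ V) (i : ℕ) : x ^ 2 ^ i ∈ V := by
  induction i with
  | zero => simpa using hx
  | succ i ih => rw [pow_succ, pow_mul]; exact hV _ ih

theorem frobeniusAlgHom_pow_apply {K : Type*} [Field K] [Algebra (ZMod 2) K]
    (i : ℕ) (x : K) :
    ((FiniteField.frobeniusAlgHom (ZMod 2) K).toLinearMap ^ i) x = x ^ 2 ^ i := by
  induction i with
  | zero => simp
  | succ i ih => rw [pow_succ', Module.End.mul_apply, ih]; simp [pow_succ, pow_mul]

theorem frobSpan_subset_subfield {K : Type*} [Field K] [Algebra (ZMod 2) K]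
    {L : Subfield K} {γ : K} (hγ : γ ∈ L) :
    (frobSpan K γ : Set K) ⊆ L := by
  intro x hx
  induction hx using Submodule.span_induction with
  | mem x hx => obtain ⟨i, rfl⟩ := hx; exact L.pow_mem hγ _
  | zero => exact L.zero_mem
  | add x y _ _ hx hy => exact L.add_mem hx hy
  | smul c x _ hx =>
    rcases (by decide : ∀ c : ZMod 2, c = 0 ∨ c = 1) c with rfl | rfl
    · simp
    · simpa using hx

theorem natCard_subfield_sq_le {K : Type*} [Field K] [Finite K] {L : Subfield K} (hL : L ≠ ⊤) :
    Nat.card L ^ 2 ≤ Nat.card K := by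
  rw [Module.natCard_eq_pow_finrank (K := L) (V := K)]
  refine Nat.pow_le_pow_right Nat.card_pos ?_
  have hpos : 0 < Module.finrank L K := Module.finrank_pos
  by_contra! hlt
  have hone : Module.finrank L K = 1 := by omega
  refine hL (eq_top_iff.2 fun x _ => ?_)
  have hbot := Subalgebra.bot_eq_top_of_finrank_eq_one hone
  obtain ⟨y, rfl⟩ := Algebra.mem_bot.1 (hbot ▸ Algebra.mem_top (x := x))
  exact y.2

theorem ncard_pow_eq_self_le {K : Type*} [Field K] [Finite K] {q : ℕ} (hq : 1 < q) :
    {x : K | x ^ q = x}.ncard ≤ q := by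
  classical
  have hne := FiniteField.X_pow_card_sub_X_ne_zero K hq
  have hsub : {x : K | x ^ q = x} ⊆ ((X ^ q - X : K[X]).roots.toFinset : Set K) := fun x hx => by
    simpa [hne, sub_eq_zero] using hx
  calc {x : K | x ^ q = x}.ncard ≤ ((X ^ q - X : K[X]).roots.toFinset : Set K).ncard :=
        Set.ncard_le_ncard hsub (Set.toFinite _)
    _ = (X ^ q - X : K[X]).roots.toFinset.card := Set.ncard_coe_finset _
    _ ≤ (X ^ q - X : K[X]).natDegree :=
        (Multiset.toFinset_card_le _).trans (Polynomial.card_roots' _)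
    _ = q := FiniteField.X_pow_card_sub_X_natDegree_eq K hq

section FieldOfCharTwo

variable {K : Type*} [Field K] [Fintype K] [Algebra (ZMod 2) K]

theorem algebraTrace_sq (x : K) :
    Algebra.trace (ZMod 2) K (x ^ 2) = Algebra.trace (ZMod 2) K x := by
  have h := Algebra.trace_eq_of_algEquiv (FiniteField.frobeniusAlgEquivOfAlgebraic (ZMod 2) K) x
  simpa using h

theorem walsh_sq {F : K → K} (hcomm : ∀ x, F (x ^ 2) = F x ^ 2) (a ω : K) :
    walsh F (a ^ 2) (ω ^ 2) = walsh F a ω := by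
  unfold walsh
  refine (Fintype.sum_bijective (fun v : K => v ^ 2) ?_ _ _ fun v => ?_).symm
  · simpa using (FiniteField.frobeniusAlgEquivOfAlgebraic (ZMod 2) K).bijective
  · rw [hcomm, ← mul_pow, ← mul_pow, algebraTrace_sq, algebraTrace_sq]

theorem IsBent.of_sq {m : ℕ} {F : K → K} (hcomm : ∀ x, F (x ^ 2) = F x ^ 2) {a : K}
    (h : IsBent m F (a ^ 2)) : IsBent m F a := fun ω => by
  rw [← walsh_sq hcomm]
  exact h _

theorem walsh_zero_zero (F : K → K) : walsh F 0 0 = Fintype.card K := by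
  simp [walsh]

theorem not_isBent_zero {m n : ℕ} (hm : 0 < m) (hn : n = 2 * m)
    (hcard : Fintype.card K = 2 ^ n) (F : K → K) : ¬ IsBent m F 0 := by
  intro h
  have hlt : (2 : ℤ) ^ m < 2 ^ n := pow_lt_pow_right₀ (by norm_num) (by omega)
  have hpos : (0 : ℤ) < 2 ^ m := by positivity
  have h0 := h 0
  rw [walsh_zero_zero, hcard] at h0
  push_cast at h0
  rcases h0 with h0 | h0 <;> linarith

/-- The sum of the characters `a ↦ (-1)^{Tr(ac)}` over a subgroup is its order or `0`. -/
theorem natCard_dvd_sum_trace_sign (U : AddSubgroup K) [DecidablePred (· ∈ U)] (c : K) :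
    (Nat.card U : ℤ) ∣
      ∑ a : U, if Algebra.trace (ZMod 2) K (a * c) = 0 then (1 : ℤ) else -1 := by
  by_cases h : ∀ a : U, Algebra.trace (ZMod 2) K (a * c) = 0
  · simp [h]
  push Not at h
  obtain ⟨a₀, h₀⟩ := h
  have one_of_ne : ∀ t : ZMod 2, t ≠ 0 → t = 1 := by decide
  have shift : ∀ t : ZMod 2, (if t + 1 = 0 then (1 : ℤ) else -1) = -(if t = 0 then 1 else -1) := by
    decide
  have hneg := Equiv.sum_comp (Equiv.addRight a₀)
    fun a : U => if Algebra.trace (ZMod 2) K (a * c) = 0 then (1 : ℤ) else -1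
  simp only [Equiv.coe_addRight, AddSubgroup.coe_add, add_mul, map_add, one_of_ne _ h₀, shift,
    Finset.sum_neg_distrib] at hneg
  rw [show (∑ a : U, if Algebra.trace (ZMod 2) K (a * c) = 0 then (1 : ℤ) else -1) = 0 by
    linarith]
  exact dvd_zero _

theorem natCard_dvd_sum_walsh_zero (U : AddSubgroup K) [DecidablePred (· ∈ U)] (F : K → K) :
    (Nat.card U : ℤ) ∣ ∑ a : U, walsh F a 0 := by
  simp only [walsh, zero_mul, map_zero, add_zero]
  rw [Finset.sum_comm]
  exact Finset.dvd_sum fun v _ => natCard_dvd_sum_trace_sign U (F v)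

/-- Nyberg's bound: a group of components that are bent apart from `0` has order at most `2 ^ m`. -/
theorem natCard_le_of_forall_isBent {m n : ℕ} (hm : 0 < m) (hn : n = 2 * m)
    (hcard : Fintype.card K = 2 ^ n) (F : K → K) (U : AddSubgroup K)
    (hU : ∀ a ∈ U, ¬ IsBent m F a → a = 0) : Nat.card U ≤ 2 ^ m := by
  classical
  by_contra! hlt
  have hdvd : Nat.card U ∣ 2 ^ n := by
    rw [← hcard, ← Nat.card_eq_fintype_card]
    exact U.card_addSubgroup_dvd_card
  obtain ⟨k, -, hk⟩ := (Nat.dvd_prime_pow Nat.prime_two).1 hdvd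
  have hmk : m + 1 ≤ k := (Nat.pow_lt_pow_iff_right (by norm_num)).1 (hk ▸ hlt)
  have hsum : (2 : ℤ) ^ (m + 1) ∣ ∑ a : U, walsh F a 0 := by
    refine dvd_trans ?_ (natCard_dvd_sum_walsh_zero U F)
    rw [hk]
    push_cast
    exact pow_dvd_pow 2 hmk
  rw [← Finset.add_sum_erase _ _ (Finset.mem_univ (0 : U))] at hsum
  have hzero : (2 : ℤ) ^ (m + 1) ∣ walsh F ((0 : U) : K) 0 := by
    rw [AddSubgroup.coe_zero, walsh_zero_zero, hcard]
    push_cast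
    exact pow_dvd_pow 2 (by omega)
  have hrest := (dvd_add_right hzero).1 hsum
  have hconst : (2 : ℤ) ^ (m + 1) ∣
      ∑ a ∈ Finset.univ.erase (0 : U), (walsh F (a : K) 0 - 2 ^ m) := by
    refine Finset.dvd_sum fun a ha => ?_
    have hbent : IsBent m F (a : K) := by
      by_contra hb
      exact (Finset.mem_erase.1 ha).1 (Subtype.ext (hU _ a.2 hb))
    rcases hbent 0 with h | h
    · simp [h]
    · exact ⟨-1, by rw [h]; ring⟩
  rw [Finset.sum_sub_distrib, dvd_sub_right hrest, Finset.sum_const,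
    Finset.card_erase_of_mem (Finset.mem_univ _), Finset.card_univ, ← Nat.card_eq_fintype_card,
    hk, nsmul_eq_mul, pow_succ', mul_dvd_mul_iff_right (by positivity)] at hconst
  obtain ⟨j, rfl⟩ := Nat.exists_eq_add_of_le' (show 1 ≤ k by omega)
  have h1 : 1 ≤ 2 ^ (j + 1) := Nat.one_le_two_pow
  push_cast [h1, pow_succ] at hconst
  omega

/-- If the non-bent components number exactly `2 ^ m`, then they are closed under addition. -/
theorem not_isBent_add {m n : ℕ} (hm : 0 < m) (hn : n = 2 * m)
    (hcard : Fintype.card K = 2 ^ n) {F : K → K}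
    (hSF : Set.ncard {a : K | ¬ IsBent m F a} = 2 ^ m) {a b : K}
    (ha : ¬ IsBent m F a) (hb : ¬ IsBent m F b) : ¬ IsBent m F (a + b) := by
  have : CharP K 2 := charP_of_injective_algebraMap (algebraMap (ZMod 2) K).injective 2
  by_contra hab
  obtain ⟨U, hU, hindex⟩ := exists_addSubgroup_index_lt_ncard
    (S := {a : K | ¬ IsBent m F a}) CharTwo.add_self_eq_zero
    (not_isBent_zero hm hn hcard F) ha hb (not_not.2 hab)
  have hle := natCard_le_of_forall_isBent hm hn hcard F U hU
  have hmul := U.card_mul_index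
  rw [Nat.card_eq_fintype_card (α := K), hcard, hn, two_mul, pow_add] at hmul
  rw [hSF] at hindex
  have hpos : 0 < 2 ^ m := by positivity
  nlinarith

theorem mem_frobSpan_iff (γ x : K) : x ∈ frobSpan K γ ↔
    ∃ p : (ZMod 2)[X], aeval (FiniteField.frobeniusAlgHom (ZMod 2) K).toLinearMap p γ = x := by
  constructor
  · intro hx
    induction hx using Submodule.span_induction with
    | mem x hx =>
      obtain ⟨i, rfl⟩ := hx
      exact ⟨X ^ i, by rw [map_pow, aeval_X, frobeniusAlgHom_pow_apply]⟩
    | zero => exact ⟨0, by simp⟩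
    | add x y _ _ hx hy =>
      obtain ⟨p, rfl⟩ := hx
      obtain ⟨q, rfl⟩ := hy
      exact ⟨p + q, by simp⟩
    | smul c x _ hx =>
      obtain ⟨p, rfl⟩ := hx
      exact ⟨c • p, by simp⟩
  · rintro ⟨p, rfl⟩
    rw [aeval_eq_sum_range, LinearMap.sum_apply]
    refine Submodule.sum_mem _ fun i _ => ?_
    rw [LinearMap.smul_apply, frobeniusAlgHom_pow_apply]
    exact Submodule.smul_mem _ _ (Submodule.subset_span ⟨i, rfl⟩)

/-- The normal basis theorem, phrased with Frobenius powers. -/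
theorem exists_frobSpan_eq_top : ∃ α : K, frobSpan K α = ⊤ := by
  refine ⟨IsGalois.normalBasis (ZMod 2) K 1, top_le_iff.1 ?_⟩
  rw [← (IsGalois.normalBasis (ZMod 2) K).span_eq, Submodule.span_le]
  rintro _ ⟨σ, rfl⟩
  obtain ⟨i, rfl⟩ := (FiniteField.bijective_frobeniusAlgEquivOfAlgebraic_pow (ZMod 2) K).2 σ
  beta_reduce
  rw [IsGalois.normalBasis_apply (FiniteField.frobeniusAlgEquivOfAlgebraic (ZMod 2) K ^ (i : ℕ)),
    AlgEquiv.coe_pow, FiniteField.coe_frobeniusAlgEquivOfAlgebraic, pow_iterate, ZMod.card]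
  exact Submodule.subset_span ⟨i, rfl⟩

/-- Every Frobenius-stable subspace is spanned by the Frobenius orbit of a single element. -/
theorem exists_frobSpan_eq (V : Submodule (ZMod 2) K) (hV : ∀ x ∈ V, x ^ 2 ∈ V) :
    ∃ γ : K, frobSpan K γ = V := by
  obtain ⟨α, hα⟩ := exists_frobSpan_eq_top (K := K)
  let φ := (FiniteField.frobeniusAlgHom (ZMod 2) K).toLinearMap
  have aeval_mem : ∀ (p : (ZMod 2)[X]) (x : K), x ∈ V → aeval φ p x ∈ V := fun p x hx =>
    Submodule.span_le.2 (Set.range_subset_iff.2 (pow_two_pow_mem hV hx))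
      ((mem_frobSpan_iff x _).2 ⟨p, rfl⟩)
  let I : Ideal (ZMod 2)[X] :=
    { carrier := {p | aeval φ p α ∈ V}
      add_mem' := fun {p q} hp hq => by simpa using V.add_mem hp hq
      zero_mem' := by simp
      smul_mem' := fun p q hq => by simpa using aeval_mem p _ hq }
  obtain ⟨g, hg⟩ := (IsPrincipalIdealRing.principal I).principal
  have hgI : g ∈ I := hg ▸ Submodule.mem_span_singleton_self g
  refine ⟨aeval φ g α, le_antisymm ?_ fun x hx => ?_⟩
  · exact Submodule.span_le.2 (Set.range_subset_iff.2 (pow_two_pow_mem hV hgI))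
  · obtain ⟨p, rfl⟩ := (mem_frobSpan_iff α x).1 (hα ▸ Submodule.mem_top)
    obtain ⟨q, rfl⟩ := Submodule.mem_span_singleton.1 (hg ▸ (show p ∈ I from hx))
    exact (mem_frobSpan_iff _ _).2 ⟨q, by simp [φ]⟩

end FieldOfCharTwo

/-- Let `n = 2m` and let `F : F_{2^n} → F_{2^n}` commute with the Frobenius with `#S_F = 2^m`.
If `ℓ(n) > m` (every generator `γ` of `F_{2^n}` over `F₂` has Frobenius-orbit span of dimension
`> m`), then `S_F = F_{2^m}`, the subfield with `2^m` elements (the set of solutions of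
`x^{2^m} = x`). -/
theorem stmt8 (m n : ℕ) (hm : 0 < m) (hn : n = 2 * m)
    (K : Type*) [Field K] [Fintype K] [Algebra (ZMod 2) K]
    (hcard : Fintype.card K = 2 ^ n)
    (F : K → K) (hcomm : ∀ x, F (x ^ 2) = (F x) ^ 2)
    (hSF : Set.ncard {a : K | ¬ IsBent m F a} = 2 ^ m)
    (hell : ∀ γ : K, Subfield.closure {γ} = ⊤ →
      m < Module.finrank (ZMod 2) (frobSpan K γ)) :
    {a : K | ¬ IsBent m F a} = {x : K | x ^ (2 ^ m) = x} := by
  have hadd : ∀ {a b : K}, ¬ IsBent m F a → ¬ IsBent m F b → ¬ IsBent m F (a + b) :=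
    not_isBent_add hm hn hcard hSF
  have hzero := not_isBent_zero hm hn hcard F
  let V : Submodule (ZMod 2) K :=
    { carrier := {a : K | ¬ IsBent m F a}
      add_mem' := hadd
      zero_mem' := hzero
      smul_mem' := fun c x hx => by
        rcases (by decide : ∀ c : ZMod 2, c = 0 ∨ c = 1) c with rfl | rfl
        · simpa using hzero
        · simpa using hx }
  have hVcard : Nat.card V = 2 ^ m := hSF
  obtain ⟨γ, hγ⟩ := exists_frobSpan_eq V fun x hx hbent => hx (hbent.of_sq hcomm)
  have hrank : Module.finrank (ZMod 2) V = m := by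
    have h := Module.natCard_eq_pow_finrank (K := ZMod 2) (V := V)
    rw [hVcard, Nat.card_zmod] at h
    exact (Nat.pow_right_injective le_rfl h).symm
  set L := Subfield.closure {γ} with hL
  have hLtop : L ≠ ⊤ := fun h => by
    have := hell γ h
    rw [hγ, hrank] at this
    exact lt_irrefl _ this
  have hVL : (V : Set K) ⊆ L :=
    hγ ▸ frobSpan_subset_subfield (Subfield.subset_closure (Set.mem_singleton γ))
  have hLle : Nat.card L ≤ 2 ^ m := by
    have h := natCard_subfield_sq_le hLtop
    rw [Nat.card_eq_fintype_card (α := K), hcard, hn, mul_comm, pow_mul] at h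
    exact (Nat.pow_le_pow_iff_left two_ne_zero).1 h
  have hLcard : Nat.card L = 2 ^ m :=
    le_antisymm hLle (hVcard ▸ Nat.card_mono (Set.toFinite (L : Set K)) hVL)
  refine Set.eq_of_subset_of_ncard_le (fun x hx => ?_) ?_ (Set.toFinite _)
  · have := Fintype.ofFinite L
    have h := FiniteField.pow_card (⟨x, hVL hx⟩ : L)
    rw [← Nat.card_eq_fintype_card, hLcard] at h
    exact congrArg Subtype.val h
  · rw [hSF]
    exact ncard_pow_eq_self_le (Nat.one_lt_two_pow hm.ne')
end

section
/- Let n = 2m, N = 2^n − 1, and F(x) = x^{d_1} + x^{d_2} on F_{2^n} with d_1, d_2 ∈ {1, …, N−1} and wt_2(d_1) = wt_2(d_2) = 2. If #S_F = 2^m, then ν_{d_1,d_2} = m, there exists (j_1, j_2) ∈ 𝒥_{d_1,d_2} with wt_2(j_1) + wt_2(j_2) = m and d_1 j_1 + d_2 j_2 ≡ 0 (mod N), and moreover there exists an integer j with 0 ≤ j ≤ 2^m − 1 such that (d_1 − d_2)·j + (2^m − 1)·d_2 ≡ 0 (mod N). -/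
open Finset

/-- `ν_{d₁,d₂} = min{V_{d₁,d₂}(j₁,j₂) : (j₁,j₂) ∈ 𝒥}`. -/
noncomputable def nuMin (N d₁ d₂ : ℕ) : ℕ := sInf ((Vfun N d₁ d₂) '' (JJ N : Set (ℕ × ℕ)))

/-- `𝒥_{d₁,d₂}`: the set of minimizers of `V_{d₁,d₂}` on `𝒥`. -/
noncomputable def Jmin (N d₁ d₂ : ℕ) : Finset (ℕ × ℕ) :=
  (JJ N).filter (fun p => Vfun N d₁ d₂ p = nuMin N d₁ d₂)

/-- The binary digit sum of a natural number. -/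
def binWeight (x : ℕ) : ℕ := (Nat.digits 2 x).sum

lemma binWeight_zero : binWeight 0 = 0 := by simp [binWeight]

lemma binWeight_step (x : ℕ) : binWeight x = x % 2 + binWeight (x / 2) := by
  rcases Nat.eq_zero_or_pos x with rfl | h
  · simp [binWeight]
  · simp [binWeight, Nat.digits_def' (by norm_num : 1 < 2) h]

lemma binWeight_two_mul (x : ℕ) : binWeight (2 * x) = binWeight x := by
  rw [binWeight_step (2 * x)]; simp

lemma binWeight_two_pow_mul (k x : ℕ) : binWeight (2 ^ k * x) = binWeight x := by
  induction k with
  | zero => simp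
  | succ k ih => rw [pow_succ', mul_assoc, binWeight_two_mul, ih]

lemma binWeight_one : binWeight 1 = 1 := by simp [binWeight]

lemma binWeight_two_pow (k : ℕ) : binWeight (2 ^ k) = 1 := by
  simpa [binWeight_one] using binWeight_two_pow_mul k 1

lemma binWeight_add_le (x y : ℕ) : binWeight (x + y) ≤ binWeight x + binWeight y := by
  induction h : x + y using Nat.strong_induction_on generalizing x y with
  | _ s ih =>
    subst h
    by_cases h1 : x % 2 + y % 2 < 2
    · rcases Nat.eq_zero_or_pos (x + y) with h0 | h0
      · obtain ⟨rfl, rfl⟩ : x = 0 ∧ y = 0 := by omega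
        simp
      rw [binWeight_step (x + y), binWeight_step x, binWeight_step y]
      have := ih (x / 2 + y / 2) (by omega) _ _ rfl
      rw [show (x + y) / 2 = x / 2 + y / 2 by omega]
      omega
    · rw [binWeight_step (x + y), binWeight_step x, binWeight_step y]
      rw [show (x + y) / 2 = (x / 2 + y / 2) + 1 by omega]
      have h2 := ih (x / 2 + y / 2) (by omega) _ _ rfl
      have h3 : binWeight (x / 2 + y / 2 + 1) ≤ binWeight (x / 2 + y / 2) + binWeight 1 := by
        by_cases h4 : x = 1 ∧ y = 1
        · obtain ⟨rfl, rfl⟩ := h4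
          simp [binWeight]
        · exact ih _ (by omega) _ _ rfl
      rw [binWeight_one] at h3
      omega

lemma binWeight_add_two_pow_mul {k r : ℕ} (hr : r < 2 ^ k) (q : ℕ) :
    binWeight (r + 2 ^ k * q) = binWeight r + binWeight q := by
  induction k generalizing r with
  | zero =>
    obtain rfl : r = 0 := by simpa using hr
    simp [binWeight_zero]
  | succ k ih =>
    rw [pow_succ'] at hr
    rw [binWeight_step (r + _), binWeight_step r, pow_succ', mul_assoc]
    rw [show (r + 2 * (2 ^ k * q)) / 2 = r / 2 + 2 ^ k * q by omega, ih (by omega)]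
    omega

lemma binWeight_two_pow_sub_one (k : ℕ) : binWeight (2 ^ k - 1) = k := by
  induction k with
  | zero => simp [binWeight_zero]
  | succ k ih =>
    have := Nat.one_le_two_pow (n := k)
    rw [binWeight_step, show (2 ^ (k + 1) - 1) / 2 = 2 ^ k - 1 by rw [pow_succ]; omega, ih,
      show (2 ^ (k + 1) - 1) % 2 = 1 by rw [pow_succ]; omega]
    omega

lemma binWeight_le_of_lt {k x : ℕ} (hx : x < 2 ^ k) : binWeight x ≤ k := by
  induction k generalizing x with
  | zero =>
    obtain rfl : x = 0 := by simpa using hx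
    simp [binWeight_zero]
  | succ k ih =>
    rw [pow_succ] at hx
    rw [binWeight_step]
    have := ih (x := x / 2) (by omega)
    omega

lemma eq_of_le_binWeight {k x : ℕ} (hx : x < 2 ^ k) (h : k ≤ binWeight x) : x = 2 ^ k - 1 := by
  induction k generalizing x with
  | zero => simpa using hx
  | succ k ih =>
    rw [pow_succ] at hx ⊢
    rw [binWeight_step] at h
    have := ih (x := x / 2) (by omega) (by omega)
    have := binWeight_le_of_lt (k := k) (x := x / 2) (by omega)
    omega

lemma eq_zero_of_binWeight_eq_zero {x : ℕ} (h : binWeight x = 0) : x = 0 := by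
  induction x using Nat.strong_induction_on with
  | _ x ih =>
    rw [binWeight_step] at h
    by_contra h0
    have := ih (x / 2) (by omega) (by omega)
    omega

lemma exists_two_pow_add_of_binWeight_eq_succ {k x : ℕ} (h : binWeight x = k + 1) :
    ∃ p y, x = 2 ^ p + y ∧ binWeight y = k := by
  induction x using Nat.strong_induction_on with
  | _ x ih =>
    rw [binWeight_step] at h
    rcases Nat.mod_two_eq_zero_or_one x with h2 | h2
    · have h0 : x ≠ 0 := by
        rintro rfl
        simp [binWeight_zero] at h
      obtain ⟨p, y, hx, hy⟩ := ih (x / 2) (by omega) (by omega)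
      refine ⟨p + 1, 2 * y, ?_, by rw [binWeight_two_mul, hy]⟩
      rw [pow_succ]
      omega
    · refine ⟨0, 2 * (x / 2), by omega, ?_⟩
      rw [binWeight_two_mul]
      omega

lemma exists_of_binWeight_eq_two {x : ℕ} (h : binWeight x = 2) : ∃ p q, x = 2 ^ p + 2 ^ q := by
  obtain ⟨p, y, rfl, hy⟩ := exists_two_pow_add_of_binWeight_eq_succ h
  obtain ⟨q, z, rfl, hz⟩ := exists_two_pow_add_of_binWeight_eq_succ hy
  exact ⟨p, q, by rw [eq_zero_of_binWeight_eq_zero hz, add_zero]⟩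

/-- Folding the bits above position `n` back preserves the residue modulo `2 ^ n - 1`. -/
lemma fold_modEq (n x : ℕ) : x % 2 ^ n + x / 2 ^ n ≡ x [MOD 2 ^ n - 1] := by
  have h1 := Nat.one_le_two_pow (n := n)
  conv_rhs => rw [← Nat.mod_add_div x (2 ^ n)]
  refine Nat.ModEq.add_left _ ?_
  have : 2 ^ n ≡ 1 [MOD 2 ^ n - 1] := by
    conv_lhs => rw [show 2 ^ n = (2 ^ n - 1) + 1 by omega]
    simp [Nat.ModEq]
  simpa using (this.mul_right (x / 2 ^ n)).symm

lemma binWeight_fold_le (n x : ℕ) : binWeight (x % 2 ^ n + x / 2 ^ n) ≤ binWeight x := by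
  refine (binWeight_add_le _ _).trans ?_
  conv_rhs => rw [← Nat.mod_add_div x (2 ^ n)]
  rw [binWeight_add_two_pow_mul (Nat.mod_lt _ (by positivity))]

lemma fold_lt {n x : ℕ} (hn : 0 < n) (hx : 2 ^ n ≤ x) : x % 2 ^ n + x / 2 ^ n < x := by
  have h2 : 2 ≤ 2 ^ n := by
    calc 2 = 2 ^ 1 := by norm_num
      _ ≤ 2 ^ n := Nat.pow_le_pow_right (by norm_num) hn
  have h3 := Nat.mod_add_div x (2 ^ n)
  have h4 : 0 < x / 2 ^ n := Nat.div_pos hx (by positivity)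
  nlinarith

lemma binWeight_mod_le {n : ℕ} (hn : 0 < n) (x : ℕ) :
    binWeight (x % (2 ^ n - 1)) ≤ binWeight x := by
  induction x using Nat.strong_induction_on with
  | _ x ih =>
    rcases lt_trichotomy x (2 ^ n - 1) with h | h | h
    · rw [Nat.mod_eq_of_lt h]
    · simp [h, binWeight_zero]
    · have := ih _ (fold_lt hn (by omega : 2 ^ n ≤ x))
      rw [fold_modEq n x] at this
      exact this.trans (binWeight_fold_le n x)

lemma le_binWeight_of_dvd {n x : ℕ} (hn : 0 < n) (hx : 0 < x) (h : 2 ^ n - 1 ∣ x) :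
    n ≤ binWeight x := by
  induction x using Nat.strong_induction_on with
  | _ x ih =>
    rcases lt_trichotomy x (2 ^ n - 1) with h1 | h1 | h1
    · exact absurd (Nat.le_of_dvd hx h) (by omega)
    · rw [h1, binWeight_two_pow_sub_one]
    · have h2 : 2 ^ n ≤ x := by omega
      have h3 : 0 < x / 2 ^ n := Nat.div_pos h2 (by positivity)
      refine (ih _ (fold_lt hn h2) (by omega) ?_).trans (binWeight_fold_le n x)
      rwa [(fold_modEq n x).dvd_iff dvd_rfl]

/-- If `x + y ≡ 2 ^ m - 1` modulo `2 ^ (2 * m) - 1` and `x`, `y` have total weight at most `m`,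
then there are no carries and the congruence is an equality. -/
lemma add_eq_of_dvd {m x y : ℕ} (hm : 0 < m) (hx : x < 2 ^ (2 * m) - 1)
    (hy : y < 2 ^ (2 * m) - 1) (hw : binWeight x + binWeight y ≤ m)
    (h : 2 ^ (2 * m) - 1 ∣ x + y + 2 ^ m * (2 ^ m - 1)) : x + y = 2 ^ m - 1 := by
  obtain ⟨c, hc⟩ := h
  obtain ⟨k, rfl⟩ : ∃ k, m = k + 1 := ⟨m - 1, by omega⟩
  set A := 2 ^ k with hA
  have hA1 : 1 ≤ A := Nat.one_le_two_pow
  have hq : 2 ^ (2 * (k + 1)) = 4 * (A * A) := by rw [hA]; ring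
  have hp : 2 ^ (k + 1) = 2 * A := by rw [hA]; ring
  have hr : 2 * A * (2 * A - 1) = 4 * (A * A) - 2 * A := by
    rw [Nat.mul_sub]; ring_nf
  have hAA : A ≤ A * A := by nlinarith
  rw [hq] at hx hy hc
  rw [hp] at hc ⊢
  rw [hr] at hc
  have hc3 : c < 3 := by
    by_contra! hcon
    have : (4 * (A * A) - 1) * 3 ≤ (4 * (A * A) - 1) * c := Nat.mul_le_mul_left _ hcon
    omega
  interval_cases c
  · omega
  · omega
  · exfalso
    have key : ∀ u v : ℕ, u < 4 * (A * A) → binWeight u + binWeight v ≤ k + 1 →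
        u + v = 4 * (A * A) + 2 * A - 2 → 2 * (A * A) ≤ u → False := by
      intro u v hu hw huv hle
      have hAp : 2 ^ (2 * k + 1) = 2 * (A * A) := by rw [hA]; ring
      have h1 : binWeight u = binWeight (u - 2 * (A * A)) + 1 := by
        have := binWeight_add_two_pow_mul (k := 2 * k + 1) (r := u - 2 * (A * A))
          (by omega) 1
        rw [hAp, mul_one, Nat.sub_add_cancel hle, binWeight_one] at this
        exact this
      have h2 : binWeight (u - 2 * (A * A) + v) = k + 1 := by
        have := binWeight_add_two_pow_mul (k := 2 * k + 1) (r := 2 * (A - 1))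
          (by omega) 1
        rw [hAp, mul_one, binWeight_one, binWeight_two_mul, hA, binWeight_two_pow_sub_one,
          ← hA] at this
        rw [← this]
        congr 1
        omega
      have := binWeight_add_le (u - 2 * (A * A)) v
      omega
    rcases le_total (2 * (A * A)) x with h1 | h1
    · exact key x y (by omega) hw (by omega) h1
    · exact key y x (by omega) (by omega) (by omega) (by omega)

/-- The Pfaffian of a symmetric matrix with zero diagonal in characteristic two, as a sum over
perfect matchings, i.e. over fixed-point-free involutions. -/
def pfaffianTwo {R : Type*} [CommRing R] {n : ℕ} (M : Matrix (Fin n) (Fin n) R) : R :=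
  ∑ σ : Equiv.Perm (Fin n) with σ⁻¹ = σ ∧ ∀ i, σ i ≠ i, ∏ i with i < σ i, M i (σ i)

lemma apply_apply_of_inv_eq_self {α : Type*} {σ : Equiv.Perm α} (hσ : σ⁻¹ = σ) (i : α) :
    σ (σ i) = i :=
  calc σ (σ i) = σ⁻¹ (σ i) := by rw [hσ]
    _ = i := by simp

lemma prod_filter_gt_eq_prod_filter_lt {M : Type*} [CommMonoid M] {n : ℕ}
    {σ : Equiv.Perm (Fin n)} (hσ : σ⁻¹ = σ) (f : Fin n → M) :
    ∏ i with σ i < i, f i = ∏ i with i < σ i, f (σ i) := by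
  have hσσ := apply_apply_of_inv_eq_self hσ
  refine Finset.prod_bij' (fun i _ => σ i) (fun i _ => σ i) ?_ ?_ ?_ ?_ ?_ <;>
    simp [hσσ]

lemma filter_not_lt_eq {n : ℕ} {σ : Equiv.Perm (Fin n)} (hσ : ∀ i, σ i ≠ i) :
    Finset.univ.filter (fun i => ¬ i < σ i) = Finset.univ.filter (fun i => σ i < i) := by
  ext i
  have := hσ i
  simp only [mem_filter, mem_univ, true_and, not_lt]
  exact ⟨fun h => lt_of_le_of_ne h this, le_of_lt⟩

lemma prod_eq_prod_filter_lt {M : Type*} [CommMonoid M] {n : ℕ} {σ : Equiv.Perm (Fin n)}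
    (hσ : σ⁻¹ = σ) (hσ' : ∀ i, σ i ≠ i) (f : Fin n → M) :
    ∏ i, f i = ∏ i with i < σ i, f i * f (σ i) := by
  rw [← Finset.prod_filter_mul_prod_filter_not univ (fun i => i < σ i), filter_not_lt_eq hσ',
    prod_filter_gt_eq_prod_filter_lt hσ, Finset.prod_mul_distrib]

lemma sum_eq_sum_filter_lt {M : Type*} [AddCommMonoid M] {n : ℕ} {σ : Equiv.Perm (Fin n)}
    (hσ : σ⁻¹ = σ) (hσ' : ∀ i, σ i ≠ i) (f : Fin n → M) :
    ∑ i, f i = ∑ i with i < σ i, (f i + f (σ i)) :=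
  prod_eq_prod_filter_lt (M := Multiplicative M) hσ hσ' f

lemma det_eq_pfaffianTwo_sq {R : Type*} [CommRing R] [CharP R 2] {n : ℕ}
    (M : Matrix (Fin n) (Fin n) R) (hsymm : ∀ i j, M i j = M j i) (hdiag : ∀ i, M i i = 0) :
    M.det = pfaffianTwo M ^ 2 := by
  have hsign : ∀ σ : Equiv.Perm (Fin n), ((Equiv.Perm.sign σ : ℤ) : R) = 1 := by
    intro σ
    rcases Int.units_eq_one_or (Equiv.Perm.sign σ) with h | h <;> simp [h, CharTwo.neg_eq]
  rw [Matrix.det_apply']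
  simp only [hsign, one_mul]
  rw [← Finset.sum_filter_add_sum_filter_not univ
    (fun σ : Equiv.Perm (Fin n) => σ⁻¹ = σ ∧ ∀ i, σ i ≠ i)]
  have hinv : ∀ σ : Equiv.Perm (Fin n), ∏ i, M (σ⁻¹ i) i = ∏ i, M (σ i) i := by
    intro σ
    rw [← Equiv.prod_comp σ]
    exact Finset.prod_congr rfl fun i _ => by simp [hsymm i]
  have hzero : ∑ σ : Equiv.Perm (Fin n) with ¬ (σ⁻¹ = σ ∧ ∀ i, σ i ≠ i),
      ∏ i, M (σ i) i = 0 := by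
    refine Finset.sum_involution (fun σ _ => σ⁻¹) ?_ ?_ ?_ ?_
    · intro σ _
      rw [hinv, CharTwo.add_self_eq_zero]
    · intro σ hσ hne heq
      simp only [mem_filter, mem_univ, true_and, not_and, not_forall, not_not] at hσ
      obtain ⟨i, hi⟩ := hσ heq
      exact hne (Finset.prod_eq_zero (mem_univ i) (by rw [hi, hdiag]))
    · intro σ hσ
      simp only [mem_filter, mem_univ, true_and, not_and, not_forall, not_not, inv_inv] at hσ ⊢
      intro h
      obtain ⟨i, hi⟩ := hσ h.symm
      exact ⟨i, by rw [← h, hi]⟩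
    · intro σ _
      simp
  rw [hzero, add_zero, pfaffianTwo, CharTwo.sum_sq]
  refine Finset.sum_congr rfl fun σ hσ => ?_
  simp only [mem_filter, mem_univ, true_and] at hσ
  rw [prod_eq_prod_filter_lt hσ.1 hσ.2, ← Finset.prod_pow]
  refine Finset.prod_congr rfl fun i _ => ?_
  rw [apply_apply_of_inv_eq_self hσ.1, hsymm (σ i) i, sq]

/-- The span of the functions `a ↦ a ^ (j₁ + j₂)` where `j₁`, `j₂` have total weight at most `r`
and `d₁ * j₁ + d₂ * j₂ ≡ c` modulo `N`. -/
def weightSpan (K : Type*) [Field K] (N d₁ d₂ r c : ℕ) : Submodule K (K → K) :=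
  Submodule.span K {f | ∃ j₁ j₂, binWeight j₁ + binWeight j₂ ≤ r ∧
    d₁ * j₁ + d₂ * j₂ ≡ c [MOD N] ∧ f = fun a => a ^ (j₁ + j₂)}

section weightSpan

variable {K : Type*} [Field K] {N d₁ d₂ : ℕ}

lemma mul_mem_weightSpan {r r' c c' : ℕ} {f g : K → K} (hf : f ∈ weightSpan K N d₁ d₂ r c)
    (hg : g ∈ weightSpan K N d₁ d₂ r' c') :
    f * g ∈ weightSpan K N d₁ d₂ (r + r') (c + c') := by
  have h := Submodule.mul_mem_mul hf hg
  rw [weightSpan, weightSpan, Submodule.span_mul_span] at h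
  refine Submodule.span_mono ?_ h
  rintro _ ⟨_, ⟨j₁, j₂, hw, hc, rfl⟩, _, ⟨k₁, k₂, hw', hc', rfl⟩, rfl⟩
  refine ⟨j₁ + k₁, j₂ + k₂, ?_, ?_, ?_⟩
  · have := binWeight_add_le j₁ k₁
    have := binWeight_add_le j₂ k₂
    omega
  · convert hc.add hc' using 1
    ring
  · ext a
    simp only [Pi.mul_apply]
    ring

lemma prod_mem_weightSpan {ι : Type*} (s : Finset ι) (f : ι → K → K) (c : ι → ℕ)
    (h : ∀ i ∈ s, f i ∈ weightSpan K N d₁ d₂ 1 (c i)) :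
    ∏ i ∈ s, f i ∈ weightSpan K N d₁ d₂ (#s) (∑ i ∈ s, c i) := by
  classical
  induction s using Finset.induction_on with
  | empty =>
    refine Submodule.subset_span ⟨0, 0, by simp [binWeight_zero], by simp [Nat.ModEq], ?_⟩
    ext a
    simp
  | insert i s hi ih =>
    rw [Finset.prod_insert hi, Finset.card_insert_of_notMem hi, Finset.sum_insert hi, add_comm]
    exact mul_mem_weightSpan (h i (mem_insert_self _ _))
      (ih fun j hj => h j (mem_insert_of_mem hj))

/-- The Pfaffian of a matrix with entries `M i j` of type `2 ^ i + 2 ^ j` is of type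
`2 ^ n - 1`. -/
lemma pfaffianTwo_mem_weightSpan {m n : ℕ} (hn : n = 2 * m) (hN : N = 2 ^ n - 1)
    (M : K → Matrix (Fin n) (Fin n) K)
    (hM : ∀ i j : Fin n, (fun a => M a i j) ∈ weightSpan K N d₁ d₂ 1 (2 ^ (i : ℕ) + 2 ^ (j : ℕ))) :
    (fun a => pfaffianTwo (M a)) ∈ weightSpan K N d₁ d₂ m N := by
  have hfun : (fun a => pfaffianTwo (M a)) =
      ∑ σ : Equiv.Perm (Fin n) with σ⁻¹ = σ ∧ ∀ i, σ i ≠ i,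
        ∏ i with i < σ i, fun a => M a i (σ i) := by
    ext a
    simp [pfaffianTwo]
  rw [hfun]
  refine Submodule.sum_mem _ fun σ hσ => ?_
  simp only [mem_filter, mem_univ, true_and] at hσ
  have h := prod_mem_weightSpan (univ.filter fun i => i < σ i) (fun i a => M a i (σ i))
    (fun i => 2 ^ (i : ℕ) + 2 ^ (σ i : ℕ)) (fun i _ => hM i (σ i))
  have hcard : #(univ.filter fun i => i < σ i) = m := by
    have := sum_eq_sum_filter_lt hσ.1 hσ.2 (fun _ => 1)
    simp at this
    omega
  have hsum : ∑ i with i < σ i, (2 ^ (i : ℕ) + 2 ^ (σ i : ℕ)) = N := by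
    rw [← sum_eq_sum_filter_lt hσ.1 hσ.2 (fun i => 2 ^ (i : ℕ)), hN,
      Fin.sum_univ_eq_sum_range (fun i => 2 ^ i) n, Nat.geomSum_eq (le_refl 2)]
    simp
  rwa [hcard, hsum] at h

end weightSpan

section shiftMatrix

variable {K : Type*} [Field K] {n : ℕ}

/-- The matrix, in the coordinates `x ^ (2 ^ i)`, of the bilinear form
`(x, z) ↦ Tr (a * x ^ (2 ^ p) * z ^ (2 ^ q))` on the field with `2 ^ n` elements. -/
def shiftMatrix (p q : Fin n) (a : K) : Matrix (Fin n) (Fin n) K :=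
  fun i j => ∑ k : Fin n, if k + p = i ∧ k + q = j then a ^ 2 ^ (k : ℕ) else 0

/-- The matrix of the polar form of `Tr (a * (x ^ (2 ^ p₁ + 2 ^ q₁) + x ^ (2 ^ p₂ + 2 ^ q₂)))`. -/
def polarMatrix (p₁ q₁ p₂ q₂ : Fin n) (a : K) : Matrix (Fin n) (Fin n) K :=
  fun i j => (shiftMatrix p₁ q₁ a i j + shiftMatrix q₁ p₁ a i j) +
    (shiftMatrix p₂ q₂ a i j + shiftMatrix q₂ p₂ a i j)

lemma shiftMatrix_swap (p q : Fin n) (a : K) (i j : Fin n) :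
    shiftMatrix p q a i j = shiftMatrix q p a j i := by
  simp only [shiftMatrix, and_comm]

lemma polarMatrix_symm (p₁ q₁ p₂ q₂ : Fin n) (a : K) (i j : Fin n) :
    polarMatrix p₁ q₁ p₂ q₂ a i j = polarMatrix p₁ q₁ p₂ q₂ a j i := by
  simp only [polarMatrix, shiftMatrix_swap _ _ a i j]
  ring

lemma polarMatrix_diag [CharP K 2] (p₁ q₁ p₂ q₂ : Fin n) (a : K) (i : Fin n) :
    polarMatrix p₁ q₁ p₂ q₂ a i i = 0 := by
  simp only [polarMatrix, shiftMatrix_swap p₁ q₁ a i i, shiftMatrix_swap p₂ q₂ a i i,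
    CharTwo.add_self_eq_zero]

lemma two_pow_val_add_modEq (i j : Fin n) :
    2 ^ ((i + j : Fin n) : ℕ) ≡ 2 ^ (i : ℕ) * 2 ^ (j : ℕ) [MOD 2 ^ n - 1] := by
  have h1 : 2 ^ n ≡ 1 [MOD 2 ^ n - 1] := by
    have := Nat.one_le_two_pow (n := n)
    conv_lhs => rw [show 2 ^ n = (2 ^ n - 1) + 1 by omega]
    simp [Nat.ModEq]
  rw [Fin.val_add, ← pow_add]
  conv_rhs => rw [← Nat.mod_add_div ((i : ℕ) + j) n, pow_add, pow_mul]
  simpa using ((h1.pow (((i : ℕ) + j) / n)).mul_left (2 ^ (((i : ℕ) + j) % n))).symm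

lemma shiftMatrix_mem_weightSpan_left {N d₁ d₂ : ℕ} (hN : N = 2 ^ n - 1) {p q : Fin n}
    (hd : d₁ = 2 ^ (p : ℕ) + 2 ^ (q : ℕ)) (i j : Fin n) :
    (fun a : K => shiftMatrix p q a i j) ∈
      weightSpan K N d₁ d₂ 1 (2 ^ (i : ℕ) + 2 ^ (j : ℕ)) := by
  have : (fun a : K => shiftMatrix p q a i j) =
      ∑ k : Fin n, fun a => if k + p = i ∧ k + q = j then a ^ 2 ^ (k : ℕ) else 0 := by
    ext a
    simp [shiftMatrix]
  rw [this]
  refine Submodule.sum_mem _ fun k _ => ?_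
  split_ifs with h
  · refine Submodule.subset_span ⟨2 ^ (k : ℕ), 0, by simp [binWeight_two_pow, binWeight_zero],
      ?_, by simp⟩
    rw [← h.1, ← h.2, hd, hN]
    refine Nat.ModEq.trans ?_
      ((two_pow_val_add_modEq k p).add (two_pow_val_add_modEq k q)).symm
    rw [show (2 ^ (p : ℕ) + 2 ^ (q : ℕ)) * 2 ^ (k : ℕ) + d₂ * 0 =
      2 ^ (k : ℕ) * 2 ^ (p : ℕ) + 2 ^ (k : ℕ) * 2 ^ (q : ℕ) by ring]
  · exact Submodule.zero_mem _

lemma weightSpan_swap (N d₁ d₂ r c : ℕ) :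
    weightSpan K N d₁ d₂ r c = weightSpan K N d₂ d₁ r c := by
  have key : ∀ e₁ e₂, weightSpan K N e₁ e₂ r c ≤ weightSpan K N e₂ e₁ r c := by
    intro e₁ e₂
    refine Submodule.span_mono ?_
    rintro _ ⟨j₁, j₂, hw, hc, rfl⟩
    exact ⟨j₂, j₁, by rwa [add_comm], by rwa [add_comm (e₂ * j₂)], by simp only [add_comm]⟩
  exact le_antisymm (key _ _) (key _ _)

lemma polarMatrix_mem_weightSpan {N d₁ d₂ : ℕ} (hN : N = 2 ^ n - 1) {p₁ q₁ p₂ q₂ : Fin n}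
    (hd₁ : d₁ = 2 ^ (p₁ : ℕ) + 2 ^ (q₁ : ℕ)) (hd₂ : d₂ = 2 ^ (p₂ : ℕ) + 2 ^ (q₂ : ℕ))
    (i j : Fin n) :
    (fun a : K => polarMatrix p₁ q₁ p₂ q₂ a i j) ∈
      weightSpan K N d₁ d₂ 1 (2 ^ (i : ℕ) + 2 ^ (j : ℕ)) := by
  refine Submodule.add_mem _ (Submodule.add_mem _ ?_ ?_) (Submodule.add_mem _ ?_ ?_)
  · exact shiftMatrix_mem_weightSpan_left hN hd₁ i j
  · exact shiftMatrix_mem_weightSpan_left hN (by rw [hd₁, add_comm]) i j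
  · rw [weightSpan_swap]
    exact shiftMatrix_mem_weightSpan_left hN hd₂ i j
  · rw [weightSpan_swap]
    exact shiftMatrix_mem_weightSpan_left hN (by rw [hd₂, add_comm]) i j

end shiftMatrix

lemma pow_two_pow_val_add {K : Type*} [Field K] [Fintype K] {n : ℕ}
    (hcard : Fintype.card K = 2 ^ n) (i j : Fin n) (x : K) :
    x ^ 2 ^ ((i + j : Fin n) : ℕ) = (x ^ 2 ^ (i : ℕ)) ^ 2 ^ (j : ℕ) := by
  rw [Fin.val_add, ← pow_mul, ← pow_add]
  conv_rhs => rw [← Nat.mod_add_div ((i : ℕ) + j) n, pow_add, pow_mul, pow_mul, ← hcard,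
    FiniteField.pow_card_pow]

/-- A linearized polynomial of degree less than the cardinality of the field which vanishes
everywhere has zero coefficients. -/
lemma eq_zero_of_forall_sum_mul_pow_eq_zero {K : Type*} [Field K] [Fintype K] {n : ℕ}
    [NeZero n] (hcard : Fintype.card K = 2 ^ n) (w : Fin n → K)
    (h : ∀ y : K, ∑ i, w i * y ^ 2 ^ (i : ℕ) = 0) : w = 0 := by
  classical
  let f : Polynomial K := ∑ i, Polynomial.C (w i) * Polynomial.X ^ 2 ^ (i : ℕ)
  have hf : f = 0 := by
    refine Polynomial.eq_zero_of_natDegree_lt_card_of_eval_eq_zero' f univ ?_ ?_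
    · intro y _
      simpa [f, Polynomial.eval_finsetSum] using h y
    · rw [card_univ, hcard]
      refine lt_of_le_of_lt (b := 2 ^ (n - 1)) ?_
        (Nat.pow_lt_pow_right (by norm_num) (Nat.sub_one_lt (NeZero.ne n)))
      refine Polynomial.natDegree_sum_le_of_forall_le _ _ fun i _ => ?_
      refine (Polynomial.natDegree_C_mul_X_pow_le _ _).trans ?_
      exact Nat.pow_le_pow_right (by norm_num) (by omega)
  funext i
  have hc := congrArg (fun g => Polynomial.coeff g (2 ^ (i : ℕ))) hf
  simp only [f, Polynomial.finsetSum_coeff, Polynomial.coeff_C_mul_X_pow,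
    Polynomial.coeff_zero] at hc
  rw [Finset.sum_eq_single i] at hc
  · simpa using hc
  · intro j _ hj
    rw [if_neg]
    intro h2
    exact hj (Fin.ext (Nat.pow_right_injective (le_refl 2) h2).symm)
  · simp

lemma sum_mul_shiftMatrix_mul {K : Type*} [Field K] [Fintype K] {n : ℕ}
    (hcard : Fintype.card K = 2 ^ n) (p q : Fin n) (a x z : K) :
    ∑ i : Fin n, ∑ j : Fin n, x ^ 2 ^ (i : ℕ) * (shiftMatrix p q a i j * z ^ 2 ^ (j : ℕ)) =
      ∑ k : Fin n, (a * (x ^ 2 ^ (p : ℕ) * z ^ 2 ^ (q : ℕ))) ^ 2 ^ (k : ℕ) := by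
  have h1 : ∀ i j : Fin n, x ^ 2 ^ (i : ℕ) * (shiftMatrix p q a i j * z ^ 2 ^ (j : ℕ)) =
      ∑ k : Fin n, if k + q = j then (if k + p = i then
        a ^ 2 ^ (k : ℕ) * (x ^ 2 ^ (i : ℕ) * z ^ 2 ^ (j : ℕ)) else 0) else 0 := by
    intro i j
    rw [shiftMatrix, Finset.sum_mul, Finset.mul_sum]
    refine Finset.sum_congr rfl fun k _ => ?_
    by_cases h1 : k + p = i <;> by_cases h2 : k + q = j <;> simp [h1, h2]
    ring
  simp only [h1]
  calc _ = ∑ i : Fin n, ∑ k : Fin n, ∑ j : Fin n, (if k + q = j then (if k + p = i then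
        a ^ 2 ^ (k : ℕ) * (x ^ 2 ^ (i : ℕ) * z ^ 2 ^ (j : ℕ)) else 0) else 0) :=
        Finset.sum_congr rfl fun i _ => Finset.sum_comm
    _ = ∑ k : Fin n, ∑ i : Fin n, ∑ j : Fin n, (if k + q = j then (if k + p = i then
        a ^ 2 ^ (k : ℕ) * (x ^ 2 ^ (i : ℕ) * z ^ 2 ^ (j : ℕ)) else 0) else 0) :=
        Finset.sum_comm
    _ = _ := by
        refine Finset.sum_congr rfl fun k _ => ?_
        simp only [Finset.sum_ite_eq, mem_univ, if_true]
        rw [add_comm k p, add_comm k q, pow_two_pow_val_add hcard, pow_two_pow_val_add hcard,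
          mul_pow, mul_pow]

section polarMap

variable {K : Type*} [Field K] [Fintype K] [CharP K 2] {n : ℕ} [NeZero n]

lemma shiftMatrix_add (hcard : Fintype.card K = 2 ^ n) (p q : Fin n) (a : K) (i j t : Fin n) :
    shiftMatrix p q a (i + t) (j + t) = shiftMatrix p q a i j ^ 2 ^ (t : ℕ) := by
  simp only [shiftMatrix]
  rw [sum_pow_char_pow, ← Equiv.sum_comp (Equiv.addRight t)]
  refine Finset.sum_congr rfl fun k _ => ?_
  have h1 : ∀ r s : Fin n, k + t + r = s + t ↔ k + r = s := fun r s => by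
    rw [add_right_comm, add_left_inj]
  simp only [Equiv.coe_addRight, h1]
  split_ifs
  · rw [pow_two_pow_val_add hcard]
  · simp

lemma polarMatrix_add (hcard : Fintype.card K = 2 ^ n) (p₁ q₁ p₂ q₂ : Fin n) (a : K)
    (i j t : Fin n) :
    polarMatrix p₁ q₁ p₂ q₂ a (i + t) (j + t) =
      polarMatrix p₁ q₁ p₂ q₂ a i j ^ 2 ^ (t : ℕ) := by
  simp only [polarMatrix, shiftMatrix_add hcard, add_pow_char_pow]

lemma sq_det_polarMatrix (hcard : Fintype.card K = 2 ^ n) (p₁ q₁ p₂ q₂ : Fin n) (a : K) :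
    (polarMatrix p₁ q₁ p₂ q₂ a).det ^ 2 = (polarMatrix p₁ q₁ p₂ q₂ a).det := by
  have hadd : ∀ i j : Fin n, polarMatrix p₁ q₁ p₂ q₂ a (i + 1) (j + 1) =
      polarMatrix p₁ q₁ p₂ q₂ a i j ^ 2 := by
    intro i j
    rw [polarMatrix_add hcard]
    rcases Nat.lt_or_ge 1 n with h | h
    · have : ((1 : Fin n) : ℕ) = 1 := by
        rw [Fin.val_one', Nat.mod_eq_of_lt h]
      rw [this, pow_one]
    · have hn1 : n = 1 := le_antisymm h (NeZero.one_le)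
      subst hn1
      have : ∀ y : K, y ^ 2 = y := fun y => by
        have := FiniteField.pow_card y
        rwa [hcard, pow_one] at this
      simp [this]
  have h : ((polarMatrix p₁ q₁ p₂ q₂ a).submatrix (Equiv.addRight 1) (Equiv.addRight 1)) =
      (polarMatrix p₁ q₁ p₂ q₂ a).map (frobenius K 2) := by
    ext i j
    simp [hadd, frobenius_def]
  have h' := congrArg Matrix.det h
  rw [Matrix.det_submatrix_equiv_self] at h'
  conv_rhs => rw [h']
  rw [← RingHom.mapMatrix_apply, ← RingHom.map_det, frobenius_def]

/-- The linear map `L` such that `Tr (x * L z)` is the bilinear form given by `polarMatrix`. -/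
def polarMap (p₁ q₁ p₂ q₂ : Fin n) (a : K) : K →+ K where
  toFun z := ∑ j, polarMatrix p₁ q₁ p₂ q₂ a 0 j * z ^ 2 ^ (j : ℕ)
  map_zero' := by simp
  map_add' x y := by simp [add_pow_char_pow, mul_add, Finset.sum_add_distrib]

lemma polarMap_pow (hcard : Fintype.card K = 2 ^ n) (p₁ q₁ p₂ q₂ : Fin n) (a z : K)
    (i : Fin n) :
    polarMap p₁ q₁ p₂ q₂ a z ^ 2 ^ (i : ℕ) =
      ∑ j, polarMatrix p₁ q₁ p₂ q₂ a i j * z ^ 2 ^ (j : ℕ) := by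
  simp only [polarMap, AddMonoidHom.coe_mk, ZeroHom.coe_mk]
  rw [sum_pow_char_pow,
    ← Equiv.sum_comp (Equiv.addRight i) (fun j => polarMatrix p₁ q₁ p₂ q₂ a i j * z ^ 2 ^ (j : ℕ))]
  refine Finset.sum_congr rfl fun j _ => ?_
  have := polarMatrix_add hcard p₁ q₁ p₂ q₂ a 0 j i
  rw [zero_add] at this
  simp only [Equiv.coe_addRight, this, mul_pow, pow_two_pow_val_add hcard]

lemma det_polarMatrix_eq_zero_iff (hcard : Fintype.card K = 2 ^ n) (p₁ q₁ p₂ q₂ : Fin n)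
    (a : K) :
    (polarMatrix p₁ q₁ p₂ q₂ a).det = 0 ↔ ∃ x ≠ 0, polarMap p₁ q₁ p₂ q₂ a x = 0 := by
  constructor
  · intro h
    by_contra! hcon
    obtain ⟨w, hw, hwM⟩ := Matrix.exists_vecMul_eq_zero_iff.mpr h
    have hinj : Function.Injective (polarMap p₁ q₁ p₂ q₂ a) := by
      rw [injective_iff_map_eq_zero]
      intro x hx
      by_contra hx0
      exact hcon x hx0 hx
    refine hw (eq_zero_of_forall_sum_mul_pow_eq_zero hcard w fun y => ?_)
    obtain ⟨z, rfl⟩ := (Finite.injective_iff_surjective.mp hinj) y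
    simp only [polarMap_pow hcard]
    have hcol : ∀ j, ∑ i, w i * polarMatrix p₁ q₁ p₂ q₂ a i j = 0 := fun j => congrFun hwM j
    simp only [Finset.mul_sum]
    rw [Finset.sum_comm]
    refine Finset.sum_eq_zero fun j _ => ?_
    simp only [← mul_assoc]
    rw [← Finset.sum_mul, hcol, zero_mul]
  · rintro ⟨x, hx, hLx⟩
    refine Matrix.exists_mulVec_eq_zero_iff.mp ⟨fun j => x ^ 2 ^ (j : ℕ), ?_, ?_⟩
    · intro h0
      have := congrFun h0 0
      exact hx (by simpa using this)
    · funext i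
      have := polarMap_pow hcard p₁ q₁ p₂ q₂ a x i
      rw [hLx, zero_pow (by positivity)] at this
      exact this.symm

end polarMap

section walsh

variable {K : Type*} [Field K] [Fintype K] [Algebra (ZMod 2) K] {n : ℕ}

lemma algebraMap_trace_eq_sum (hcard : Fintype.card K = 2 ^ n) (y : K) :
    algebraMap (ZMod 2) K (Algebra.trace (ZMod 2) K y) = ∑ i : Fin n, y ^ 2 ^ (i : ℕ) := by
  have hrank : Module.finrank (ZMod 2) K = n := by
    have := Module.card_eq_pow_finrank (K := ZMod 2) (V := K)
    rw [hcard, ZMod.card] at this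
    exact (Nat.pow_right_injective (le_refl 2) this).symm
  rw [FiniteField.algebraMap_trace_eq_sum_pow, hrank, Nat.card_zmod,
    Fin.sum_univ_eq_sum_range (fun i => y ^ 2 ^ i)]

lemma trace_polar [CharP K 2] [NeZero n] (hcard : Fintype.card K = 2 ^ n) {d₁ d₂ : ℕ}
    {p₁ q₁ p₂ q₂ : Fin n} (hd₁ : d₁ = 2 ^ (p₁ : ℕ) + 2 ^ (q₁ : ℕ))
    (hd₂ : d₂ = 2 ^ (p₂ : ℕ) + 2 ^ (q₂ : ℕ)) (a x z : K) :
    Algebra.trace (ZMod 2) K (a * ((x + z) ^ d₁ + (x + z) ^ d₂)) =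
      Algebra.trace (ZMod 2) K (a * (x ^ d₁ + x ^ d₂)) +
      Algebra.trace (ZMod 2) K (a * (z ^ d₁ + z ^ d₂)) +
      Algebra.trace (ZMod 2) K (x * polarMap p₁ q₁ p₂ q₂ a z) := by
  have hL : Algebra.trace (ZMod 2) K (x * polarMap p₁ q₁ p₂ q₂ a z) =
      Algebra.trace (ZMod 2) K ((a * (x ^ 2 ^ (p₁ : ℕ) * z ^ 2 ^ (q₁ : ℕ)) +
        a * (x ^ 2 ^ (q₁ : ℕ) * z ^ 2 ^ (p₁ : ℕ))) +
        (a * (x ^ 2 ^ (p₂ : ℕ) * z ^ 2 ^ (q₂ : ℕ)) +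
        a * (x ^ 2 ^ (q₂ : ℕ) * z ^ 2 ^ (p₂ : ℕ)))) := by
    apply (algebraMap (ZMod 2) K).injective
    simp only [map_add]
    simp only [algebraMap_trace_eq_sum hcard, mul_pow x, polarMap_pow hcard,
      ← sum_mul_shiftMatrix_mul hcard, polarMatrix, Finset.mul_sum, add_mul, mul_add,
      Finset.sum_add_distrib]
  rw [hL, ← map_add, ← map_add]
  congr 1
  rw [hd₁, hd₂]
  simp only [pow_add, add_pow_char_pow]
  ring

/-- The nontrivial additive character of `ZMod 2`. -/
def signChar (t : ZMod 2) : ℤ := if t = 0 then 1 else -1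

lemma signChar_add (s t : ZMod 2) : signChar (s + t) = signChar s * signChar t := by
  revert s t
  decide

lemma sum_signChar_trace_mul [DecidableEq K] (y : K) :
    ∑ x : K, signChar (Algebra.trace (ZMod 2) K (x * y)) =
      if y = 0 then (Fintype.card K : ℤ) else 0 := by
  split_ifs with h
  · simp [h, signChar]
  · obtain ⟨b, hb⟩ : ∃ b : K, Algebra.trace (ZMod 2) K (b * y) ≠ 0 := by
      by_contra! hcon
      exact h ((traceForm_nondegenerate (ZMod 2) K).1 y fun b => by
        rw [Algebra.traceForm_apply, mul_comm]
        exact hcon b)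
    have h1 : signChar (Algebra.trace (ZMod 2) K (b * y)) = -1 := if_neg hb
    have h2 := Equiv.sum_comp (Equiv.addRight b)
      (fun x : K => signChar (Algebra.trace (ZMod 2) K (x * y)))
    simp only [Equiv.coe_addRight, add_mul, map_add, signChar_add, h1] at h2
    rw [← Finset.sum_mul] at h2
    linarith

lemma walsh_sq_s11 [DecidableEq K] {F : K → K} {a : K} (L : K →+ K)
    (hL : ∀ x z, Algebra.trace (ZMod 2) K (a * F (x + z)) =
      Algebra.trace (ZMod 2) K (a * F x) + Algebra.trace (ZMod 2) K (a * F z) +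
      Algebra.trace (ZMod 2) K (x * L z)) (ω : K) :
    walsh F a ω ^ 2 = Fintype.card K * ∑ z with L z = 0,
      signChar (Algebra.trace (ZMod 2) K (a * F z) + Algebra.trace (ZMod 2) K (ω * z)) := by
  set Q : K → ZMod 2 := fun v =>
    Algebra.trace (ZMod 2) K (a * F v) + Algebra.trace (ZMod 2) K (ω * v) with hQ
  have hw : walsh F a ω = ∑ v, signChar (Q v) := rfl
  have hpolar : ∀ x z, Q x + Q (x + z) = Q z + Algebra.trace (ZMod 2) K (x * L z) := by
    intro x z
    simp only [hQ, hL, mul_add, map_add]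
    linear_combination (CharTwo.add_self_eq_zero (Algebra.trace (ZMod 2) K (a * F x)))
      + (CharTwo.add_self_eq_zero (Algebra.trace (ZMod 2) K (ω * x)))
  rw [hw, sq, Finset.sum_mul_sum]
  calc ∑ x, ∑ y, signChar (Q x) * signChar (Q y)
      = ∑ x, ∑ z, signChar (Q z) * signChar (Algebra.trace (ZMod 2) K (x * L z)) := by
        refine Finset.sum_congr rfl fun x _ => ?_
        rw [← Equiv.sum_comp (Equiv.addLeft x)]
        refine Finset.sum_congr rfl fun z _ => ?_
        rw [← signChar_add, ← signChar_add, Equiv.coe_addLeft, hpolar]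
    _ = ∑ z, signChar (Q z) * (if L z = 0 then (Fintype.card K : ℤ) else 0) := by
        rw [Finset.sum_comm]
        refine Finset.sum_congr rfl fun z _ => ?_
        rw [← Finset.mul_sum, sum_signChar_trace_mul]
    _ = _ := by
        rw [Finset.mul_sum, Finset.sum_filter]
        refine Finset.sum_congr rfl fun z _ => ?_
        split_ifs <;> ring

lemma isBent_iff {m : ℕ} (hcard : Fintype.card K = 2 ^ (2 * m)) {F : K → K} {a : K}
    (hF0 : F 0 = 0) (L : K →+ K)
    (hL : ∀ x z, Algebra.trace (ZMod 2) K (a * F (x + z)) =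
      Algebra.trace (ZMod 2) K (a * F x) + Algebra.trace (ZMod 2) K (a * F z) +
      Algebra.trace (ZMod 2) K (x * L z)) :
    IsBent m F a ↔ ∀ x, L x = 0 → x = 0 := by
  classical
  have hq : (Fintype.card K : ℤ) = (2 ^ m) ^ 2 := by
    rw [hcard]
    push_cast
    ring
  constructor
  · intro hb x hx
    by_contra hx0
    have h1 := walsh_sq_s11 L hL 0
    have h2 : walsh F a 0 ^ 2 = (2 ^ m) ^ 2 := by
      rcases hb 0 with h | h <;> rw [h]
      ring
    rw [h2, hq] at h1
    have h3 : ∑ z with L z = 0, signChar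
        (Algebra.trace (ZMod 2) K (a * F z) + Algebra.trace (ZMod 2) K (0 * z)) = 1 := by
      have hpos : ((2 : ℤ) ^ m) ^ 2 ≠ 0 := by positivity
      exact mul_left_cancel₀ hpos (by rw [← h1, mul_one])
    have h4 := congrArg (Int.cast : ℤ → ZMod 2) h3
    have hodd : ∀ t : ZMod 2, ((signChar t : ℤ) : ZMod 2) = 1 := by decide
    simp only [Int.cast_sum, hodd, Int.cast_one] at h4
    have : CharP K 2 := charP_of_injective_algebraMap (algebraMap (ZMod 2) K).injective 2
    have h5 : ∑ z : K with L z = 0, (1 : ZMod 2) = 0 := by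
      refine Finset.sum_involution (fun z _ => z + x) ?_ ?_ ?_ ?_
      · intro _ _
        decide
      · intro z _ _ h
        exact hx0 (by simpa using h)
      · intro z hz
        simpa [hx] using hz
      · intro z _
        simp [add_assoc, CharTwo.add_self_eq_zero]
    rw [h5] at h4
    exact zero_ne_one h4
  · intro hinj ω
    have h1 := walsh_sq_s11 L hL ω
    have h2 : Finset.univ.filter (fun z => L z = 0) = {0} := by
      ext z
      simp only [mem_filter, mem_univ, true_and, mem_singleton]
      exact ⟨hinj z, fun h => by rw [h, map_zero]⟩
    rw [h2, hq] at h1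
    simp only [sum_singleton, hF0, mul_zero, map_zero, add_zero] at h1
    rw [show signChar 0 = 1 from rfl, mul_one] at h1
    exact sq_eq_sq_iff_eq_or_eq_neg.mp h1

end walsh

lemma exists_sum_pow_ne_zero {K : Type*} [Field K] {S : Finset K} (hS : S.Nonempty) :
    ∃ i < #S, ∑ x ∈ S, x ^ i ≠ 0 := by
  classical
  obtain ⟨s, hs⟩ := hS
  by_contra! hcon
  let f : Polynomial K := ∏ x ∈ S.erase s, (Polynomial.X - Polynomial.C x)
  have hdeg : f.natDegree < #S := by
    rw [Polynomial.natDegree_prod_of_monic _ _ fun x _ => Polynomial.monic_X_sub_C x]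
    simp [Finset.card_erase_of_mem hs, Finset.card_pos.mpr ⟨s, hs⟩]
  have heval : ∀ y, f.eval y = ∏ x ∈ S.erase s, (y - x) := fun y => by
    simp [f, Polynomial.eval_prod]
  have h1 : ∑ y ∈ S, f.eval y = f.eval s := by
    refine Finset.sum_eq_single_of_mem s hs fun y hy hne => ?_
    rw [heval]
    exact Finset.prod_eq_zero (mem_erase.mpr ⟨hne, hy⟩) (sub_self y)
  have h2 : ∑ y ∈ S, f.eval y = 0 := by
    simp only [Polynomial.eval_eq_sum_range' hdeg]
    rw [Finset.sum_comm]
    refine Finset.sum_eq_zero fun i hi => ?_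
    rw [← Finset.mul_sum, hcon i (mem_range.mp hi), mul_zero]
  rw [h1, heval, Finset.prod_eq_zero_iff] at h2
  obtain ⟨x, hx, hx0⟩ := h2
  exact (mem_erase.mp hx).1 (sub_eq_zero.mp hx0).symm

lemma dvd_of_sum_pow_ne_zero {K : Type*} [Field K] [Fintype K] {k : ℕ}
    (h : ∑ x : K, x ^ k ≠ 0) : 0 < k ∧ Fintype.card K - 1 ∣ k := by
  have hq : 0 < Fintype.card K - 1 := Nat.sub_pos_of_lt Fintype.one_lt_card
  constructor
  · rw [Nat.pos_iff_ne_zero]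
    rintro rfl
    exact h (FiniteField.sum_pow_lt_card_sub_one K 0 hq)
  · rw [Nat.dvd_iff_mod_eq_zero]
    by_contra hk
    refine h ?_
    rw [← FiniteField.sum_pow_lt_card_sub_one K _ (Nat.mod_lt k hq)]
    refine Finset.sum_congr rfl fun x _ => ?_
    by_cases hx : x = 0
    · rw [hx, zero_pow hk, zero_pow]
      rintro rfl
      simp at hk
    · conv_lhs => rw [← Nat.mod_add_div k (Fintype.card K - 1), pow_add, pow_mul,
        FiniteField.pow_card_sub_one_eq_one x hx, one_pow, mul_one]

lemma exists_of_sum_mul_pow_ne_zero {K : Type*} [Field K] [Fintype K] {N d₁ d₂ r c e : ℕ}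
    {f : K → K} (hf : f ∈ weightSpan K N d₁ d₂ r c) (h : ∑ x, f x * x ^ e ≠ 0) :
    ∃ j₁ j₂, binWeight j₁ + binWeight j₂ ≤ r ∧ d₁ * j₁ + d₂ * j₂ ≡ c [MOD N] ∧
      ∑ x : K, x ^ (j₁ + j₂ + e) ≠ 0 := by
  by_contra! hcon
  refine h ?_
  refine Submodule.span_induction (p := fun g _ => ∑ x, g x * x ^ e = 0) ?_ ?_ ?_ ?_ hf
  · rintro _ ⟨j₁, j₂, hw, hc, rfl⟩
    simpa [pow_add] using hcon j₁ j₂ hw hc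
  · simp
  · intro g g' _ _ hg hg'
    simp [add_mul, Finset.sum_add_distrib, hg, hg']
  · intro b g _ hg
    simp [mul_assoc, ← Finset.mul_sum, hg]

/-- If the indicator of the complement of a set of `2 ^ m` elements lies in the span of weight
at most `m`, then one of the exponents of the span is `≡ 2 ^ m - 1`. -/
lemma exists_exponents {K : Type*} [Field K] [Fintype K] [CharP K 2] {m N d₁ d₂ c : ℕ}
    (hm : 0 < m) (hN : N = 2 ^ (2 * m) - 1) (hcard : Fintype.card K = 2 ^ (2 * m))
    {P : K → K} (hP : P ∈ weightSpan K N d₁ d₂ m c) {S : Finset K}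
    (hPS : ∀ x ∈ S, P x = 0) (hPS' : ∀ x ∉ S, P x = 1) (hS : #S = 2 ^ m) :
    ∃ j₁ j₂, binWeight j₁ + binWeight j₂ ≤ m ∧ d₁ * j₁ + d₂ * j₂ ≡ c [MOD N] ∧
      N ∣ j₁ + j₂ + 2 ^ m * (2 ^ m - 1) := by
  classical
  have hlt : 2 ^ m < 2 ^ (2 * m) := Nat.pow_lt_pow_right (by norm_num) (by omega)
  obtain ⟨i, hi, hne⟩ := exists_sum_pow_ne_zero (S := S)
    (Finset.card_pos.mp (by rw [hS]; positivity))
  rw [hS] at hi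
  have hsum : ∑ x, P x * x ^ i ≠ 0 := by
    have h1 : ∑ x : K, x ^ i = 0 := FiniteField.sum_pow_lt_card_sub_one K i (by omega)
    have h2 : ∑ x ∈ S, x ^ i = ∑ x : K, (x ^ i - P x * x ^ i) := by
      rw [← Finset.sum_subset (Finset.subset_univ S)]
      · exact Finset.sum_congr rfl fun x hx => by rw [hPS x hx]; ring
      · intro x _ hx
        rw [hPS' x hx]
        ring
    rw [Finset.sum_sub_distrib, h1, zero_sub] at h2
    rw [h2] at hne
    exact neg_ne_zero.mp hne
  have hsum' : ∑ x, P x * x ^ (2 ^ m * i) ≠ 0 := by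
    have h1 := pow_ne_zero (2 ^ m) hsum
    rw [sum_pow_char_pow] at h1
    convert h1 using 2 with x
    rw [mul_pow, ← pow_mul, mul_comm i]
    congr 1
    by_cases hx : x ∈ S
    · rw [hPS x hx, zero_pow (by positivity)]
    · rw [hPS' x hx, one_pow]
  obtain ⟨j₁, j₂, hw, hc, hj⟩ := exists_of_sum_mul_pow_ne_zero hP hsum'
  obtain ⟨hpos, hdvd⟩ := dvd_of_sum_pow_ne_zero hj
  rw [hcard] at hdvd
  have h1 := le_binWeight_of_dvd (by omega) hpos hdvd
  have h2 := binWeight_add_le (j₁ + j₂) (2 ^ m * i)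
  have h3 := binWeight_add_le j₁ j₂
  rw [binWeight_two_pow_mul] at h2
  have hi' := eq_of_le_binWeight hi (by omega)
  refine ⟨j₁, j₂, hw, hc, ?_⟩
  rwa [hN, ← hi']

lemma wt2_natCast (N j : ℕ) : wt2 N (j : ℤ) = binWeight (j % N) := by
  rw [wt2, binWeight, ← Int.natCast_mod, Int.toNat_natCast]

lemma le_Vfun {m N p₁ q₁ p₂ q₂ : ℕ} (hm : 0 < m) (hN : N = 2 ^ (2 * m) - 1) {p : ℕ × ℕ}
    (hp : p ∈ JJ N) : m ≤ Vfun N (2 ^ p₁ + 2 ^ q₁) (2 ^ p₂ + 2 ^ q₂) p := by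
  obtain ⟨j₁, j₂⟩ := p
  simp only [JJ, mem_erase, mem_product, mem_range, ne_eq, Prod.mk.injEq] at hp
  obtain ⟨hne, h1, h2⟩ := hp
  have hN0 : (0 : ℤ) < N := by omega
  set t : ℤ := (((2 ^ p₁ + 2 ^ q₁ : ℕ) : ℤ) * j₁ + ((2 ^ p₂ + 2 ^ q₂ : ℕ) : ℤ) * j₂) with ht
  set r := ((-t) % (N : ℤ)).toNat with hr
  have hrr : (r : ℤ) = (-t) % (N : ℤ) := Int.toNat_of_nonneg (Int.emod_nonneg _ hN0.ne')
  set X := ((2 ^ p₁ * j₁ + 2 ^ q₁ * j₁) + (2 ^ p₂ * j₂ + 2 ^ q₂ * j₂)) + r with hX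
  have hdvd : N ∣ X := by
    have h3 : (N : ℤ) ∣ (X : ℤ) := by
      have h4 := Int.emod_add_mul_ediv (-t) N
      refine ⟨-((-t) / N), ?_⟩
      have : (X : ℤ) = t + r := by
        rw [hX, ht]
        push_cast
        ring
      rw [this, hrr]
      linarith
    exact_mod_cast h3
  have hpos : 0 < X := by
    have : 0 < j₁ ∨ 0 < j₂ := by omega
    rcases this with h | h
    · have : 0 < 2 ^ p₁ * j₁ := by positivity
      omega
    · have : 0 < 2 ^ p₂ * j₂ := by positivity
      omega
  rw [hN] at hdvd
  have hw := le_binWeight_of_dvd (by omega) hpos hdvd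
  have e1 := binWeight_add_le ((2 ^ p₁ * j₁ + 2 ^ q₁ * j₁) + (2 ^ p₂ * j₂ + 2 ^ q₂ * j₂)) r
  have e2 := binWeight_add_le (2 ^ p₁ * j₁ + 2 ^ q₁ * j₁) (2 ^ p₂ * j₂ + 2 ^ q₂ * j₂)
  have e3 := binWeight_add_le (2 ^ p₁ * j₁) (2 ^ q₁ * j₁)
  have e4 := binWeight_add_le (2 ^ p₂ * j₂) (2 ^ q₂ * j₂)
  simp only [binWeight_two_pow_mul] at e3 e4
  have e5 : Vfun N (2 ^ p₁ + 2 ^ q₁) (2 ^ p₂ + 2 ^ q₂) (j₁, j₂) =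
      binWeight j₁ + binWeight j₂ + binWeight r := by
    simp only [Vfun, wt2_natCast, Nat.mod_eq_of_lt h1, Nat.mod_eq_of_lt h2]
    rfl
  rw [← hX] at e1
  omega

lemma exists_fin_of_wt2_eq_two {n N d : ℕ} (hN : N = 2 ^ n - 1) (hd : 1 ≤ d) (hd' : d ≤ N - 1)
    (hw : wt2 N (d : ℤ) = 2) : ∃ p q : Fin n, d = 2 ^ (p : ℕ) + 2 ^ (q : ℕ) := by
  rw [wt2_natCast, Nat.mod_eq_of_lt (by omega)] at hw
  obtain ⟨p, q, h⟩ := exists_of_binWeight_eq_two hw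
  have hp0 : 0 < 2 ^ p := by positivity
  have hq0 : 0 < 2 ^ q := by positivity
  have hp : p < n := (Nat.pow_lt_pow_iff_right (le_refl 2)).mp (by omega)
  have hq : q < n := (Nat.pow_lt_pow_iff_right (le_refl 2)).mp (by omega)
  exact ⟨⟨p, hp⟩, ⟨q, hq⟩, h⟩

/-- Let `n = 2m`, `N = 2^n − 1`, `F(x) = x^{d₁} + x^{d₂}` with `wt₂(d₁) = wt₂(d₂) = 2`.
If `#S_F = 2^m`, then `ν_{d₁,d₂} = m`, there exists `(j₁, j₂) ∈ 𝒥_{d₁,d₂}` with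
`wt₂(j₁) + wt₂(j₂) = m` and `d₁j₁ + d₂j₂ ≡ 0 (mod N)`, and there is `0 ≤ j ≤ 2^m − 1` with
`(d₁ − d₂)·j + (2^m − 1)·d₂ ≡ 0 (mod N)`. -/
theorem stmt11 (m n : ℕ) (hm : 0 < m) (hn : n = 2 * m) (N : ℕ) (hN : N = 2 ^ n - 1)
    (K : Type*) [Field K] [Fintype K] [Algebra (ZMod 2) K]
    (hcard : Fintype.card K = 2 ^ n)
    (d₁ d₂ : ℕ) (hd₁ : 1 ≤ d₁) (hd₁' : d₁ ≤ N - 1) (hd₂ : 1 ≤ d₂) (hd₂' : d₂ ≤ N - 1)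
    (hw₁ : wt2 N (d₁ : ℤ) = 2) (hw₂ : wt2 N (d₂ : ℤ) = 2)
    (F : K → K) (hF : ∀ x, F x = x ^ d₁ + x ^ d₂)
    (hSF : Set.ncard {a : K | ¬ IsBent m F a} = 2 ^ m) :
    nuMin N d₁ d₂ = m ∧
    (∃ p ∈ Jmin N d₁ d₂,
      wt2 N (p.1 : ℤ) + wt2 N (p.2 : ℤ) = m ∧
      (N : ℤ) ∣ ((d₁ : ℤ) * p.1 + (d₂ : ℤ) * p.2)) ∧
    (∃ j : ℕ, j ≤ 2 ^ m - 1 ∧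
      (N : ℤ) ∣ (((d₁ : ℤ) - (d₂ : ℤ)) * j + ((2 : ℤ) ^ m - 1) * d₂)) := by
  classical
  subst hn
  have : NeZero (2 * m) := ⟨by omega⟩
  have : CharP K 2 := charP_of_injective_algebraMap (algebraMap (ZMod 2) K).injective 2
  obtain ⟨p₁, q₁, e₁⟩ := exists_fin_of_wt2_eq_two hN hd₁ hd₁' hw₁
  obtain ⟨p₂, q₂, e₂⟩ := exists_fin_of_wt2_eq_two hN hd₂ hd₂' hw₂
  let P : K → K := fun a => pfaffianTwo (polarMatrix p₁ q₁ p₂ q₂ a)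
  have hdet : ∀ a, (polarMatrix p₁ q₁ p₂ q₂ a).det = P a ^ 2 := fun a =>
    det_eq_pfaffianTwo_sq _ (polarMatrix_symm p₁ q₁ p₂ q₂ a) (polarMatrix_diag p₁ q₁ p₂ q₂ a)
  have hP : P ∈ weightSpan K N d₁ d₂ m N :=
    pfaffianTwo_mem_weightSpan rfl hN _ fun i j => polarMatrix_mem_weightSpan hN e₁ e₂ i j
  have hbent : ∀ a, ¬ IsBent m F a ↔ P a = 0 := by
    intro a
    have hF0 : F 0 = 0 := by
      rw [hF, zero_pow (by omega), zero_pow (by omega), add_zero]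
    rw [isBent_iff hcard hF0 (polarMap p₁ q₁ p₂ q₂ a)
      (fun x z => by simpa only [hF] using trace_polar hcard e₁ e₂ a x z),
      ← sq_eq_zero_iff, ← hdet, det_polarMatrix_eq_zero_iff hcard]
    push Not
    exact exists_congr fun x => and_comm
  have hP01 : ∀ a, P a ≠ 0 → P a = 1 := by
    intro a ha
    have h := sq_det_polarMatrix hcard p₁ q₁ p₂ q₂ a
    rw [hdet, sq (P a ^ 2)] at h
    have h1 : P a ^ 2 = 1 := mul_left_cancel₀ (pow_ne_zero 2 ha) (by rw [h, mul_one])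
    rcases sq_eq_one_iff.mp h1 with h | h
    · exact h
    · rw [h, CharTwo.neg_eq]
  have hS : #(univ.filter fun a => P a = 0) = 2 ^ m := by
    rw [← hSF, ← Set.ncard_coe_finset]
    congr 1
    ext a
    simp [hbent]
  obtain ⟨k₁, k₂, hw, hc, hk⟩ := exists_exponents hm hN hcard hP
    (S := univ.filter fun a => P a = 0) (fun x hx => (mem_filter.mp hx).2)
    (fun x hx => hP01 x fun h => hx (mem_filter.mpr ⟨mem_univ x, h⟩)) hS
  have hlt : 2 ^ m < 2 ^ (2 * m) := Nat.pow_lt_pow_right (by norm_num) (by omega)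
  have hm2 : 2 ^ 1 ≤ 2 ^ m := Nat.pow_le_pow_right (by norm_num) hm
  have hN0 : 0 < N := by omega
  set j₁ := k₁ % N with hj₁
  set j₂ := k₂ % N with hj₂
  have hj₁N : j₁ < N := Nat.mod_lt _ hN0
  have hj₂N : j₂ < N := Nat.mod_lt _ hN0
  have hwj : binWeight j₁ + binWeight j₂ ≤ m := by
    have h1 := binWeight_mod_le (n := 2 * m) (by omega) k₁
    have h2 := binWeight_mod_le (n := 2 * m) (by omega) k₂
    rw [← hN] at h1 h2
    rw [hj₁, hj₂]
    omega
  have hsum : j₁ + j₂ = 2 ^ m - 1 := by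
    refine add_eq_of_dvd hm (hN ▸ hj₁N) (hN ▸ hj₂N) hwj ?_
    rw [← hN]
    refine (Nat.ModEq.dvd_iff (Nat.ModEq.add_right _ ?_) dvd_rfl).mpr hk
    exact (Nat.mod_modEq k₁ N).add (Nat.mod_modEq k₂ N)
  have hdvd : N ∣ d₁ * j₁ + d₂ * j₂ := by
    refine (Nat.ModEq.dvd_iff (Nat.ModEq.trans ?_ hc) dvd_rfl).mpr dvd_rfl
    exact ((Nat.mod_modEq k₁ N).mul_left d₁).add ((Nat.mod_modEq k₂ N).mul_left d₂)
  have hdvdZ : (N : ℤ) ∣ (d₁ : ℤ) * j₁ + (d₂ : ℤ) * j₂ := by exact_mod_cast hdvd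
  have hmem : (j₁, j₂) ∈ JJ N := by
    simp only [JJ, mem_erase, mem_product, mem_range, ne_eq, Prod.mk.injEq]
    exact ⟨by omega, hj₁N, hj₂N⟩
  have hV : Vfun N d₁ d₂ (j₁, j₂) = binWeight j₁ + binWeight j₂ := by
    simp only [Vfun, wt2_natCast, Nat.mod_eq_of_lt hj₁N, Nat.mod_eq_of_lt hj₂N]
    rw [wt2, Int.emod_eq_zero_of_dvd ((dvd_neg).mpr hdvdZ)]
    simp
  have hle : ∀ p ∈ JJ N, m ≤ Vfun N d₁ d₂ p := by
    intro p hp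
    rw [e₁, e₂]
    exact le_Vfun hm hN hp
  have hVm : Vfun N d₁ d₂ (j₁, j₂) = m := le_antisymm (hV ▸ hwj) (hle _ hmem)
  have hnu : nuMin N d₁ d₂ = m := by
    refine IsLeast.csInf_eq ⟨⟨(j₁, j₂), hmem, hVm⟩, ?_⟩
    rintro _ ⟨p, hp, rfl⟩
    exact hle p hp
  refine ⟨hnu, ⟨(j₁, j₂), ?_, ?_, hdvdZ⟩, j₁, by omega, ?_⟩
  · rw [Jmin, mem_filter]
    exact ⟨hmem, by rw [hnu, hVm]⟩
  · simp only [wt2_natCast, Nat.mod_eq_of_lt hj₁N, Nat.mod_eq_of_lt hj₂N]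
    rw [← hV, hVm]
  · have h1 : (2 : ℤ) ^ m - 1 = j₁ + j₂ := by
      have h2 : j₁ + j₂ + 1 = 2 ^ m := by omega
      have h3 : ((j₁ : ℤ) + j₂ + 1) = 2 ^ m := by exact_mod_cast h2
      linarith
    rw [h1]
    convert hdvdZ using 1
    ring
end
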